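/- With the setup below, assume in addition y_l ≥ √3/2 for all 1 ≤ l ≤ n−1. For every A > 0 there exists a constant C > 0 depending only on n and A such that: for every n×n real matrix γ with |(z⁻¹ γ z)_{ij}| ≤ A for all 1 ≤ i, j ≤ n, one has |γ_{ij}| ≤ C · Y_{ij}^{−1} for all 1 ≤ i, j ≤ n. -/

import Mathlib

open Matrix

/-- The diagonal Iwasawa coordinates: `t k = y 1 * y 2 * ⋯ * y (n - k)` for the `k`-th
(1-based) diagonal entry; here `k : Fin n` is 0-based, so `t k = ∏_{l=1}^{n-1-k} y l`. -/
noncomputable def tvec (n : ℕ) (y : ℕ → ℝ) : Fin n → ℝ :=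
  fun k => ∏ l ∈ Finset.Icc 1 (n - 1 - (k : ℕ)), y l

/-- `Y i j = t j / t i`. -/
noncomputable def Ymat (n : ℕ) (y : ℕ → ℝ) (i j : Fin n) : ℝ := tvec n y j / tvec n y i

/-- `z = x * y` with `y` the diagonal matrix with entries `t k`. -/
noncomputable def zmat (n : ℕ) (x : Matrix (Fin n) (Fin n) ℝ) (y : ℕ → ℝ) :
    Matrix (Fin n) (Fin n) ℝ :=
  x * Matrix.diagonal (tvec n y)

namespace Matrix

variable {ι : Type*} [Fintype ι]

lemma abs_mul_apply_le {a b : ℝ} {M N : Matrix ι ι ℝ} (ha : 0 ≤ a)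
    (hM : ∀ i j, |M i j| ≤ a) (hN : ∀ i j, |N i j| ≤ b) (i j : ι) :
    |(M * N) i j| ≤ Fintype.card ι * (a * b) := by
  rw [mul_apply]
  calc |∑ k, M i k * N k j| ≤ ∑ k, |M i k * N k j| := Finset.abs_sum_le_sum_abs _ _
    _ ≤ ∑ _k : ι, a * b := Finset.sum_le_sum fun k _ ↦ by
        rw [abs_mul]
        exact mul_le_mul (hM i k) (hN k j) (abs_nonneg _) ha
    _ = Fintype.card ι * (a * b) := by simp

lemma abs_inv_apply_le_of_det_eq_one [DecidableEq ι] {c : ℝ} {M : Matrix ι ι ℝ} (hc : 1 ≤ c)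
    (hdet : M.det = 1) (hM : ∀ i j, |M i j| ≤ c) (i j : ι) :
    |M⁻¹ i j| ≤ (Fintype.card ι).factorial * c ^ Fintype.card ι := by
  have hrow : ∀ k l, |M.updateRow j (Pi.single i 1) k l| ≤ c := by
    intro k l
    rw [updateRow_apply]
    split_ifs
    · rw [Pi.single_apply]
      split_ifs <;> simp <;> linarith
    · exact hM k l
  have h := det_le (abv := AbsoluteValue.abs) hrow
  rw [inv_def, hdet, Ring.inverse_one, one_smul, adjugate_apply]
  simpa using h

end Matrix

lemma tvec_pos {n : ℕ} {y : ℕ → ℝ} (hy : ∀ l, 1 ≤ l → l ≤ n - 1 → 0 < y l) (k : Fin n) :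
    0 < tvec n y k :=
  Finset.prod_pos fun l hl ↦ by
    rw [Finset.mem_Icc] at hl
    exact hy l hl.1 (by omega)

lemma tvec_mul_pow_le {n : ℕ} {y : ℕ → ℝ} {r : ℝ} (hr : 0 < r) (hr1 : r ≤ 1)
    (hy : ∀ l, 1 ≤ l → l ≤ n - 1 → r ≤ y l) {i j : Fin n} (hij : i ≤ j) :
    tvec n y j * r ^ n ≤ tvec n y i := by
  have hpos := tvec_pos (fun l h h' ↦ hr.trans_le (hy l h h')) j
  have hsub : Finset.Icc 1 (n - 1 - (j : ℕ)) ⊆ Finset.Icc 1 (n - 1 - (i : ℕ)) :=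
    Finset.Icc_subset_Icc_right (by have : (i : ℕ) ≤ j := hij; omega)
  set s := Finset.Icc 1 (n - 1 - (i : ℕ)) \ Finset.Icc 1 (n - 1 - (j : ℕ)) with hs
  have hcard : s.card ≤ n := by
    refine (Finset.card_le_card Finset.sdiff_subset).trans ?_
    rw [Nat.card_Icc]
    omega
  have hprod : r ^ n ≤ ∏ l ∈ s, y l := by
    calc r ^ n ≤ r ^ s.card := pow_le_pow_of_le_one hr.le hr1 hcard
      _ = ∏ _l ∈ s, r := by simp
      _ ≤ ∏ l ∈ s, y l := Finset.prod_le_prod (fun _ _ ↦ hr.le) fun l hl ↦ by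
          rw [hs, Finset.mem_sdiff, Finset.mem_Icc] at hl
          exact hy l hl.1.1 (by omega)
  have hsplit : (∏ l ∈ s, y l) * tvec n y j = tvec n y i := Finset.prod_sdiff hsub
  rw [← hsplit, mul_comm]
  exact mul_le_mul_of_nonneg_right hprod hpos.le

/-- With the Siegel-domain conditions `y l ≥ √3/2`: for every `A > 0` there is `C > 0`
depending only on `n` and `A` such that any real matrix `γ` with all entries of `z⁻¹ γ z`
bounded by `A` satisfies `|γ i j| ≤ C * (Y i j)⁻¹` for all `i, j`. -/
theorem stmt_4 (n : ℕ) (hn : 2 ≤ n) (A : ℝ) (hA : 0 < A) :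
    ∃ C : ℝ, 0 < C ∧
      ∀ (x : Matrix (Fin n) (Fin n) ℝ),
        (∀ i, x i i = 1) → (∀ i j : Fin n, j < i → x i j = 0) →
        (∀ i j : Fin n, i < j → |x i j| ≤ 1 / 2) →
      ∀ (y : ℕ → ℝ), (∀ l, 1 ≤ l → l ≤ n - 1 → 0 < y l) →
        (∀ l, 1 ≤ l → l ≤ n - 1 → Real.sqrt 3 / 2 ≤ y l) →
      ∀ (γ : Matrix (Fin n) (Fin n) ℝ),
        (∀ i j : Fin n, |((zmat n x y)⁻¹ * γ * zmat n x y) i j| ≤ A) →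
        ∀ i j : Fin n, |γ i j| ≤ C * (Ymat n y i j)⁻¹ := by
  obtain ⟨r, hr_def⟩ : ∃ r, r = Real.sqrt 3 / 2 := ⟨_, rfl⟩
  have hr : 0 < r := by rw [hr_def]; positivity
  have hr1 : r ≤ 1 := by
    rw [hr_def, div_le_one two_pos, Real.sqrt_le_left two_pos.le]
    norm_num
  rw [← hr_def]
  set c := (r ^ n)⁻¹ with hc_def
  have hc : 1 ≤ c := (one_le_inv₀ (pow_pos hr n)).2 (pow_le_one₀ hr.le hr1)
  have hc0 : 0 < c := one_pos.trans_le hc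
  have hn0 : (0 : ℝ) < n := by exact_mod_cast (by omega : 0 < n)
  refine ⟨n * (n * (c * A) * (n.factorial * c ^ n)), by positivity, ?_⟩
  intro x hdiag hlow hup y hy hyr γ hγ i j
  have ht := tvec_pos hy
  set t := tvec n y with ht_def
  set w : Matrix (Fin n) (Fin n) ℝ := of fun i j ↦ (t i)⁻¹ * x i j * t j with hw_def
  have hz : zmat n x y = diagonal t * w := by
    ext a b
    have := (ht a).ne'
    simp [zmat, hw_def, ← ht_def]
    field_simp
  have hwb : ∀ a b, |w a b| ≤ c := by
    intro a b
    rcases lt_or_ge b a with hab | hab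
    · simp [hw_def, hlow a b hab, hc0.le]
    have hx : |x a b| ≤ 1 := by
      rcases hab.eq_or_lt with rfl | h
      · simp [hdiag]
      · linarith [hup a b h]
    have htab : (t a)⁻¹ * t b ≤ c := by
      rw [hc_def, inv_mul_le_iff₀ (ht a), ← div_eq_mul_inv, le_div_iff₀ (pow_pos hr n)]
      exact tvec_mul_pow_le hr hr1 hyr hab
    calc |w a b| = |x a b| * ((t a)⁻¹ * t b) := by
          simp only [hw_def, of_apply, abs_mul, abs_inv, abs_of_pos (ht a), abs_of_pos (ht b)]
          ring
      _ ≤ 1 * c := mul_le_mul hx htab (mul_pos (inv_pos.2 (ht a)) (ht b)).le zero_le_one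
      _ = c := one_mul c
  have hwdet : w.det = 1 := by
    have htri : w.IsUpperTriangular := fun a b hab ↦ by simp [hw_def, hlow a b hab]
    rw [det_of_isUpperTriangular htri]
    refine Finset.prod_eq_one fun a _ ↦ ?_
    simp [hw_def, hdiag, (ht a).ne']
  have hwu : IsUnit w.det := by simp [hwdet]
  have hconj : w * ((zmat n x y)⁻¹ * γ * zmat n x y) * w⁻¹ =
      diagonal (fun k ↦ (t k)⁻¹) * γ * diagonal t := by
    have hinv : (diagonal t)⁻¹ = diagonal (fun k ↦ (t k)⁻¹) :=
      inv_eq_left_inv (by simp [fun k ↦ (ht k).ne'])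
    rw [hz, Matrix.mul_inv_rev, hinv]
    simp only [Matrix.mul_assoc, mul_nonsing_inv _ hwu, Matrix.mul_one]
    rw [mul_nonsing_inv_cancel_left _ _ hwu]
  have hbound := abs_mul_apply_le (by positivity) (abs_mul_apply_le hc0.le hwb hγ)
    (abs_inv_apply_le_of_det_eq_one hc hwdet hwb) i j
  rw [hconj] at hbound
  simp only [mul_diagonal, diagonal_mul, Fintype.card_fin, abs_mul, abs_inv,
    abs_of_pos (ht i), abs_of_pos (ht j)] at hbound
  rw [Ymat, inv_div, ← ht_def]
  calc |γ i j| = (t i)⁻¹ * |γ i j| * t j * (t i / t j) := by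
        have := (ht i).ne'
        have := (ht j).ne'
        field_simp
    _ ≤ _ := mul_le_mul_of_nonneg_right hbound (div_pos (ht i) (ht j)).le
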